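/- Let V be an injective presheaf over a poset 𝒜 with an interaction decomposition {S_γ}_{γ∈𝒜}, and for γ∈𝒜 let F_{S^γ} be the sheaf on X^𝒜 induced by the subpresheaf S^γ. If γ is final in its connected component of 𝒜 (every element α of the connected component of γ satisfies α→γ), then H^0(X^𝒜; F_{S^γ}) ≅ S_γ, the stalk at γ; otherwise H^0(X^𝒜; F_{S^γ}) = 0. -/

import Mathlib

universe u v

/-- An injective presheaf of `K`-vector spaces over a poset `A`: an arrow `α → β` of the
poset means `β ≤ α`, and the structure map `j h : V β →ₗ[K] V α` attached to an arrow
`α → β` (i.e. to `h : β ≤ α`) is injective. -/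
structure InjPresheaf (A : Type u) [PartialOrder A] (K : Type v) [Field K] where
  V : A → Type v
  addStr : ∀ α, AddCommGroup (V α)
  modStr : ∀ α, Module K (V α)
  j : ∀ {α β : A}, β ≤ α → V β →ₗ[K] V α
  j_id : ∀ (α : A) (x : V α), j (le_refl α) x = x
  j_comp : ∀ {α β γ : A} (h₁ : γ ≤ β) (h₂ : β ≤ α) (x : V γ), j h₂ (j h₁ x) = j (h₁.trans h₂) x
  j_inj : ∀ {α β : A} (h : β ≤ α), Function.Injective (j h)

attribute [instance] InjPresheaf.addStr InjPresheaf.modStr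

namespace InjPresheaf

variable {A : Type u} [PartialOrder A] {K : Type v} [Field K]

/-- The family `{S_γ}` is an interaction decomposition of `W`: for every `α`, `V α` is the
internal direct sum of the subspaces `j_{αβ}(S_β)` over all `β` with `β ≤ α`. -/
def IsInteractionDecomposition (W : InjPresheaf A K) (S : ∀ γ : A, Submodule K (W.V γ)) :
    Prop :=
  ∀ α : A,
    letI : DecidableEq {β : A // β ≤ α} := Classical.decEq _
    DirectSum.IsInternal (fun β : {β : A // β ≤ α} => Submodule.map (W.j β.2) (S β.1))

/-- The subpresheaf `S^γ`: `S^γ(α) = j_{αγ}(S_γ)` if there is an arrow `α → γ`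
(i.e. `γ ≤ α`), and `S^γ(α) = 0` otherwise. -/
noncomputable def Sgamma (W : InjPresheaf A K) (S : ∀ γ : A, Submodule K (W.V γ)) (γ α : A) :
    Submodule K (W.V α) :=
  letI : Decidable (γ ≤ α) := Classical.dec _
  if h : γ ≤ α then Submodule.map (W.j h) (S γ) else ⊥

/-- Global sections of the sheaf `F_{S^γ}` on `X^𝒜`: families `(s_α)_{α ∈ 𝒜}` with
`s_α ∈ S^γ(α)` which are compatible, i.e. `j_{α'α}(s_α) = s_{α'}` whenever `α ≤ α'`.
This is `H⁰(X^𝒜; F_{S^γ})`. -/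
def globalSecS (W : InjPresheaf A K) (S : ∀ γ : A, Submodule K (W.V γ)) (γ : A) :
    Submodule K (∀ α : A, W.V α) where
  carrier := {s | (∀ α : A, s α ∈ Sgamma W S γ α) ∧
    ∀ ⦃α α' : A⦄ (h : α ≤ α'), W.j h (s α) = s α'}
  add_mem' := fun {s} {t} hs ht =>
    ⟨fun α => (Sgamma W S γ α).add_mem (hs.1 α) (ht.1 α),
     fun α α' h => by simp only [Pi.add_apply, map_add, hs.2 h, ht.2 h]⟩
  zero_mem' :=
    ⟨fun α => (Sgamma W S γ α).zero_mem, fun α α' h => by simp⟩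
  smul_mem' := fun c s hs =>
    ⟨fun α => (Sgamma W S γ α).smul_mem c (hs.1 α),
     fun α α' h => by simp only [Pi.smul_apply, map_smul, hs.2 h]⟩

end InjPresheaf

/-- `γ` is final in its connected component: every element `α` of the connected component
of `γ` (for the equivalence relation generated by the order) satisfies `α → γ`,
i.e. `γ ≤ α`. -/
def IsFinalInComponent (A : Type u) [PartialOrder A] (γ : A) : Prop :=
  ∀ α : A, Relation.EqvGen (· ≤ ·) α γ → γ ≤ α

open InjPresheaf

namespace InjPresheaf

variable {A : Type u} [PartialOrder A] {K : Type v} [Field K]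
  {W : InjPresheaf A K} {S : ∀ γ : A, Submodule K (W.V γ)} {γ : A}

lemma Sgamma_of_le {α : A} (h : γ ≤ α) : Sgamma W S γ α = Submodule.map (W.j h) (S γ) :=
  dif_pos h

lemma Sgamma_of_not_le {α : A} (h : ¬ γ ≤ α) : Sgamma W S γ α = ⊥ :=
  dif_neg h

lemma Sgamma_self : Sgamma W S γ γ = S γ := by
  have hid : W.j (le_refl γ) = LinearMap.id := LinearMap.ext (W.j_id γ)
  rw [Sgamma_of_le le_rfl, hid, Submodule.map_id]

lemma apply_eq_zero_of_not_le {s : ∀ α, W.V α} (hs : s ∈ globalSecS W S γ) {α : A}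
    (h : ¬ γ ≤ α) : s α = 0 := by
  simpa [Sgamma_of_not_le h] using hs.1 α

/-- A global section of `F_{S^γ}` is determined by its value at `γ`. -/
lemma eq_zero_of_apply_self_eq_zero {s : ∀ α, W.V α} (hs : s ∈ globalSecS W S γ)
    (h : s γ = 0) : s = 0 := by
  funext α
  by_cases hα : γ ≤ α
  · rw [← hs.2 hα, h, map_zero, Pi.zero_apply]
  · exact apply_eq_zero_of_not_le hs hα

/-- The vanishing locus of a global section is a union of connected components. -/
lemma apply_eq_zero_iff_of_eqvGen {s : ∀ α, W.V α} (hs : s ∈ globalSecS W S γ) {α β : A}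
    (h : Relation.EqvGen (· ≤ ·) α β) : s α = 0 ↔ s β = 0 := by
  induction h with
  | rel α β h => rw [← hs.2 h, map_eq_zero_iff _ (W.j_inj h)]
  | refl => rfl
  | symm _ _ _ ih => exact ih.symm
  | trans _ _ _ _ _ ih₁ ih₂ => exact ih₁.trans ih₂

/-- Evaluation of global sections of `F_{S^γ}` at `γ`. -/
def evalSelf (W : InjPresheaf A K) (S : ∀ γ : A, Submodule K (W.V γ)) (γ : A) :
    globalSecS W S γ →ₗ[K] S γ :=
  ((LinearMap.proj γ).comp (globalSecS W S γ).subtype).codRestrict (S γ)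
    fun s => Sgamma_self.le (s.2.1 γ)

lemma evalSelf_injective : Function.Injective (evalSelf W S γ) := by
  rw [injective_iff_map_eq_zero]
  intro s hs
  exact Subtype.ext (eq_zero_of_apply_self_eq_zero s.2 (congrArg Subtype.val hs))

open Classical in
/-- Extension by zero of the translates of `x` is a global section when `γ` is final in its
component. -/
lemma extend_mem_globalSecS (hγ : IsFinalInComponent A γ) {x : W.V γ} (hx : x ∈ S γ) :
    (fun α => if h : γ ≤ α then W.j h x else 0) ∈ globalSecS W S γ := by
  refine ⟨fun α => ?_, fun α β h => ?_⟩
  · by_cases hα : γ ≤ α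
    · simpa only [dif_pos hα, Sgamma_of_le hα] using Submodule.mem_map_of_mem hx
    · simp only [dif_neg hα, Submodule.zero_mem]
  · by_cases hα : γ ≤ α
    · simp only [dif_pos hα, dif_pos (hα.trans h), W.j_comp]
    · have hβ : ¬ γ ≤ β := fun hβ =>
        hα (hγ α ((Relation.EqvGen.rel _ _ h).trans _ _ _ (.symm _ _ (.rel _ _ hβ))))
      simp only [dif_neg hα, dif_neg hβ, map_zero]

lemma evalSelf_surjective (hγ : IsFinalInComponent A γ) :
    Function.Surjective (evalSelf W S γ) := fun x =>
  ⟨⟨_, extend_mem_globalSecS hγ x.2⟩,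
    Subtype.ext ((dif_pos (le_refl γ)).trans (W.j_id γ x))⟩

end InjPresheaf

/-- Let `V` be an injective presheaf over a poset `𝒜` with an interaction
decomposition `{S_γ}`.  If `γ` is final in its connected component, then
`H⁰(X^𝒜; F_{S^γ}) ≅ S_γ` (the stalk at `γ`); otherwise `H⁰(X^𝒜; F_{S^γ}) = 0`. -/
theorem globalSections_of_interaction_summand
    {A : Type u} [PartialOrder A] {K : Type v} [Field K]
    (W : InjPresheaf A K) (S : ∀ γ : A, Submodule K (W.V γ))
    (hS : W.IsInteractionDecomposition S) (γ : A) :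
    (IsFinalInComponent A γ →
      Nonempty (↥(globalSecS W S γ) ≃ₗ[K] ↥(S γ))) ∧
    (¬ IsFinalInComponent A γ → globalSecS W S γ = ⊥) := by
  refine ⟨fun hγ => ⟨.ofBijective (evalSelf W S γ)
    ⟨evalSelf_injective, evalSelf_surjective hγ⟩⟩, fun hγ => ?_⟩
  obtain ⟨α, hα, hle⟩ : ∃ α, Relation.EqvGen (· ≤ ·) α γ ∧ ¬ γ ≤ α := by
    simpa only [IsFinalInComponent, not_forall, exists_prop] using hγ
  refine (Submodule.eq_bot_iff _).2 fun s hs => eq_zero_of_apply_self_eq_zero hs ?_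
  exact (apply_eq_zero_iff_of_eqvGen hs hα).1 (apply_eq_zero_of_not_le hs hle)
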